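/- Let N > 0 and g < 0 be real numbers and let w(x) = exp(-N(x^2/2 - (g/4)x^4)) be the quartic matrix-model weight. Suppose (P_n)_{n≥0} is a family of monic orthogonal polynomials for w, with norming constants h_n = ∫_ℝ P_n(x)^2 w(x) dx and recursive coefficients γ_0 = 0 and γ_n = h_n/h_{n-1} for n ≥ 1. Then the γ_n satisfy the discrete Painlevé I (string) equation: for every integer n ≥ 1, n/N = γ_n − g·γ_n·(γ_{n+1} + γ_n + γ_{n−1}). -/

import Mathlib

open MeasureTheory Polynomial

/-- The quartic matrix-model weight `w(x) = exp(-N(x²/2 - (g/4)x⁴))`. -/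
noncomputable def quarticWeight (N g : ℝ) (x : ℝ) : ℝ :=
  Real.exp (-N * (x ^ 2 / 2 - g / 4 * x ^ 4))

section WeightFunctional

variable {N g : ℝ}

theorem continuous_quarticWeight (N g : ℝ) : Continuous (quarticWeight N g) := by
  unfold quarticWeight
  fun_prop

theorem quarticWeight_le_gaussian (hN : 0 < N) (hg : g < 0) (x : ℝ) :
    quarticWeight N g x ≤ Real.exp (-(N / 2) * x ^ 2) := by
  unfold quarticWeight
  apply Real.exp_le_exp.mpr
  have : 0 ≤ N * (-g) * x ^ 4 := by
    have : 0 < -g := by linarith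
    positivity
  nlinarith

theorem hasDerivAt_quarticWeight (N g x : ℝ) :
    HasDerivAt (quarticWeight N g) (-N * (x - g * x ^ 3) * quarticWeight N g x) x := by
  have h1 : HasDerivAt (fun x : ℝ => -N * (x ^ 2 / 2 - g / 4 * x ^ 4))
      (-N * (x - g * x ^ 3)) x := by
    refine ((((hasDerivAt_pow 2 x).div_const 2).sub
      ((hasDerivAt_pow 4 x).const_mul (g / 4))).const_mul (-N)).congr_deriv ?_
    push_cast
    ring
  rw [mul_comm]
  exact h1.exp

theorem integrable_eval_mul_quarticWeight (hN : 0 < N) (hg : g < 0) (p : ℝ[X]) :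
    Integrable fun x : ℝ => p.eval x * quarticWeight N g x := by
  induction p using Polynomial.induction_on' with
  | add p q hp hq =>
    simp only [eval_add, add_mul]
    exact hp.add hq
  | monomial n a =>
    have key : Integrable fun x : ℝ => x ^ n * Real.exp (-(N / 2) * x ^ 2) := by
      have hn : (-1 : ℝ) < n := by
        have : (0 : ℝ) ≤ n := n.cast_nonneg
        linarith
      simpa using integrable_rpow_mul_exp_neg_mul_sq (half_pos hN) hn
    have hw : Integrable fun x : ℝ => x ^ n * quarticWeight N g x := by
      refine key.mono
        ((continuous_pow n).mul (continuous_quarticWeight N g)).aestronglyMeasurable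
        (Filter.Eventually.of_forall fun x => ?_)
      have hpos : 0 ≤ quarticWeight N g x := (Real.exp_pos _).le
      rw [norm_mul, norm_mul, Real.norm_of_nonneg hpos, Real.norm_of_nonneg (Real.exp_pos _).le]
      exact mul_le_mul_of_nonneg_left (quarticWeight_le_gaussian hN hg x) (norm_nonneg _)
    simpa [mul_assoc] using hw.const_mul a

/-- Integration of polynomials against the quartic weight, as a linear functional. -/
noncomputable def quarticFunctional (hN : 0 < N) (hg : g < 0) : ℝ[X] →ₗ[ℝ] ℝ where
  toFun p := ∫ x : ℝ, p.eval x * quarticWeight N g x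
  map_add' p q := by
    simp only [eval_add, add_mul]
    exact integral_add (integrable_eval_mul_quarticWeight hN hg p)
      (integrable_eval_mul_quarticWeight hN hg q)
  map_smul' a p := by
    simp only [eval_smul, smul_eq_mul, mul_assoc, RingHom.id_apply]
    exact integral_const_mul a _

theorem quarticFunctional_apply (hN : 0 < N) (hg : g < 0) (p : ℝ[X]) :
    quarticFunctional hN hg p = ∫ x : ℝ, p.eval x * quarticWeight N g x := rfl

theorem quarticFunctional_comp_neg_X (hN : 0 < N) (hg : g < 0) (p : ℝ[X]) :
    quarticFunctional hN hg (p.comp (-X)) = quarticFunctional hN hg p := by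
  rw [quarticFunctional_apply, quarticFunctional_apply,
    ← integral_neg_eq_self (fun x : ℝ => p.eval x * quarticWeight N g x)]
  congr 1 with x
  have : quarticWeight N g (-x) = quarticWeight N g x := by
    unfold quarticWeight
    congr 1
    ring
  simp [this]

theorem quarticFunctional_derivative (hN : 0 < N) (hg : g < 0) (p : ℝ[X]) :
    quarticFunctional hN hg (derivative p) =
      N * (quarticFunctional hN hg (X * p) - g * quarticFunctional hN hg (X ^ 3 * p)) := by
  have h0 : quarticFunctional hN hg (derivative p - N • (X * p - g • (X ^ 3 * p))) = 0 := by
    refine integral_eq_zero_of_hasDerivAt_of_integrable (fun x => ?_)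
      (integrable_eval_mul_quarticWeight hN hg _) (integrable_eval_mul_quarticWeight hN hg p)
    refine ((p.hasDerivAt x).mul (hasDerivAt_quarticWeight N g x)).congr_deriv ?_
    simp only [eval_sub, eval_smul, eval_mul, eval_X, eval_pow, smul_eq_mul]
    ring
  simp only [map_sub, map_smul, smul_eq_mul] at h0
  linarith

theorem eq_zero_of_quarticFunctional_mul_self_eq_zero (hN : 0 < N) (hg : g < 0) {p : ℝ[X]}
    (hp : quarticFunctional hN hg (p * p) = 0) : p = 0 := by
  have hint := integrable_eval_mul_quarticWeight hN hg (p * p)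
  have hnonneg : 0 ≤ fun x : ℝ => (p * p).eval x * quarticWeight N g x := fun x => by
    change 0 ≤ (p * p).eval x * quarticWeight N g x
    rw [eval_mul]
    exact mul_nonneg (mul_self_nonneg (p.eval x)) (Real.exp_pos _).le
  have hae := (integral_eq_zero_iff_of_nonneg hnonneg hint).mp hp
  have hzero := (((p * p).continuous.mul (continuous_quarticWeight N g)).ae_eq_iff_eq
    volume continuous_zero).mp hae
  refine Polynomial.funext fun x => ?_
  have hx := congrFun hzero x
  have hw : quarticWeight N g x ≠ 0 := (Real.exp_pos _).ne'
  simpa [hw] using hx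

end WeightFunctional

section Orthogonal

variable {L : ℝ[X] →ₗ[ℝ] ℝ} {P : ℕ → ℝ[X]}

theorem functional_mul_eq_zero_of_degree_lt (hmonic : ∀ n, (P n).Monic)
    (hdeg : ∀ n, (P n).natDegree = n) {n : ℕ} {r : ℝ[X]} (hr : ∀ k < n, L (r * P k) = 0)
    {q : ℝ[X]} (hq : q.degree < n) : L (r * q) = 0 := by
  induction n generalizing q with
  | zero =>
    have : q = 0 := by simpa using hq
    simp [this]
  | succ n ih =>
    have hsub : (q - q.coeff n • P n).degree < n := by
      rw [degree_lt_iff_coeff_zero] at hq ⊢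
      intro m hm
      rcases hm.eq_or_lt with rfl | hm
      · have := (hmonic n).coeff_natDegree
        rw [hdeg] at this
        simp [this]
      · have : (P n).coeff m = 0 := coeff_eq_zero_of_natDegree_lt (by rwa [hdeg])
        simp [this, hq m hm]
    have h1 := ih (fun k hk => hr k (by omega)) hsub
    have h2 := hr n (by omega)
    simpa [mul_sub, h2] using h1

theorem eq_zero_of_functional_mul_eq_zero (hmonic : ∀ n, (P n).Monic)
    (hdeg : ∀ n, (P n).natDegree = n) (hdef : ∀ p, L (p * p) = 0 → p = 0) {n : ℕ} {r : ℝ[X]}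
    (hdegr : r.degree < n) (hr : ∀ k < n, L (r * P k) = 0) : r = 0 :=
  hdef r (functional_mul_eq_zero_of_degree_lt hmonic hdeg hr hdegr)

theorem functional_orthogonal_mul_eq_coeff (hmonic : ∀ n, (P n).Monic)
    (hdeg : ∀ n, (P n).natDegree = n) (horth : ∀ m n, m ≠ n → L (P m * P n) = 0) {n : ℕ}
    {q : ℝ[X]} (hq : q.natDegree ≤ n) : L (P n * q) = q.coeff n * L (P n * P n) := by
  have hc : (P n).coeff n = 1 := by
    have := (hmonic n).coeff_natDegree
    rwa [hdeg] at this
  have hsub : (q - q.coeff n • P n).degree < n := by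
    rw [degree_lt_iff_coeff_zero]
    intro m hm
    rcases hm.eq_or_lt with rfl | hm
    · simp [hc]
    · have h1 : (P n).coeff m = 0 := coeff_eq_zero_of_natDegree_lt (by rwa [hdeg])
      have h2 : q.coeff m = 0 := coeff_eq_zero_of_natDegree_lt (by omega)
      simp [h1, h2]
  have := functional_mul_eq_zero_of_degree_lt hmonic hdeg
    (fun k hk => horth n k hk.ne') hsub
  rw [mul_sub, map_sub, mul_smul_comm, map_smul, smul_eq_mul] at this
  linarith

theorem orthogonal_comp_neg_X (hmonic : ∀ n, (P n).Monic) (hdeg : ∀ n, (P n).natDegree = n)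
    (horth : ∀ m n, m ≠ n → L (P m * P n) = 0) (hdef : ∀ p, L (p * p) = 0 → p = 0)
    (heven : ∀ p : ℝ[X], L (p.comp (-X)) = L p) (n : ℕ) :
    (P n).comp (-X) = (-1 : ℝ) ^ n • P n := by
  have hnd : ∀ k, ((P k).comp (-X)).natDegree = k := fun k => by
    rw [natDegree_comp, natDegree_neg, natDegree_X, hdeg, mul_one]
  have hc : ((P n).comp (-X)).coeff n = (-1) ^ n := by
    have := comp_neg_X_leadingCoeff_eq (P n)
    rwa [leadingCoeff, hnd, hdeg, (hmonic n).leadingCoeff, mul_one] at this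
  have hswap : ∀ k, L ((P n).comp (-X) * P k) = L (P n * (P k).comp (-X)) := fun k => by
    rw [← heven, mul_comp, comp_assoc]
    simp
  rw [← sub_eq_zero]
  refine eq_zero_of_functional_mul_eq_zero hmonic hdeg hdef (n := n + 1) ?_ fun k hk => ?_
  · rw [degree_lt_iff_coeff_zero]
    intro m hm
    have h1 : (P n).coeff m = 0 := coeff_eq_zero_of_natDegree_lt (by rw [hdeg]; omega)
    have h2 : ((P n).comp (-X)).coeff m = 0 :=
      coeff_eq_zero_of_natDegree_lt (by rw [hnd]; omega)
    simp [h1, h2]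
  · rw [sub_mul, map_sub, hswap, smul_mul_assoc, map_smul, smul_eq_mul,
      functional_orthogonal_mul_eq_coeff hmonic hdeg horth (by rw [hnd]; omega)]
    rcases (Nat.lt_succ_iff.mp hk).eq_or_lt with rfl | hk
    · rw [hc, sub_self]
    · rw [coeff_eq_zero_of_natDegree_lt (by rwa [hnd]), horth n k hk.ne']
      simp

theorem functional_X_mul_orthogonal_mul_self (hmonic : ∀ n, (P n).Monic)
    (hdeg : ∀ n, (P n).natDegree = n) (horth : ∀ m n, m ≠ n → L (P m * P n) = 0)
    (hdef : ∀ p, L (p * p) = 0 → p = 0) (heven : ∀ p : ℝ[X], L (p.comp (-X)) = L p) (n : ℕ) :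
    L (X * P n * P n) = 0 := by
  have h1 := heven (X * P n * P n)
  rw [mul_comp, mul_comp, X_comp, orthogonal_comp_neg_X hmonic hdeg horth hdef heven n,
    mul_smul_comm, mul_smul_comm, smul_mul_assoc, smul_smul, ← mul_pow, neg_mul_neg, one_mul,
    one_pow, one_smul, neg_mul, neg_mul, map_neg] at h1
  linarith

theorem X_mul_orthogonal (hmonic : ∀ n, (P n).Monic)
    (hdeg : ∀ n, (P n).natDegree = n) (horth : ∀ m n, m ≠ n → L (P m * P n) = 0)
    (hdef : ∀ p, L (p * p) = 0 → p = 0) (heven : ∀ p : ℝ[X], L (p.comp (-X)) = L p)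
    {γ : ℕ → ℝ} (hγ0 : γ 0 = 0)
    (hγ : ∀ n, γ (n + 1) * L (P n * P n) = L (P (n + 1) * P (n + 1))) (n : ℕ) :
    X * P n = P (n + 1) + γ n • P (n - 1) := by
  have hc : ∀ k, (P k).coeff k = 1 := fun k => by
    have := (hmonic k).coeff_natDegree
    rwa [hdeg] at this
  have hXdeg : ∀ k, (X * P k).natDegree = k + 1 := fun k => by
    rw [natDegree_X_mul (hmonic k).ne_zero, hdeg]
  rw [← sub_eq_zero]
  refine eq_zero_of_functional_mul_eq_zero hmonic hdeg hdef (n := n + 1) ?_ fun k hk => ?_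
  · rw [degree_lt_iff_coeff_zero]
    intro m hm
    obtain ⟨m, rfl⟩ : ∃ j, m = j + 1 := ⟨m - 1, by omega⟩
    have h1 : (P (n - 1)).coeff (m + 1) = 0 :=
      coeff_eq_zero_of_natDegree_lt (by rw [hdeg]; omega)
    rcases (Nat.succ_le_succ_iff.mp hm).eq_or_lt with rfl | hm
    · simp [hc, h1, coeff_X_mul]
    · have h2 : (P n).coeff m = 0 := coeff_eq_zero_of_natDegree_lt (by rwa [hdeg])
      have h3 : (P (n + 1)).coeff (m + 1) = 0 :=
        coeff_eq_zero_of_natDegree_lt (by rw [hdeg]; omega)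
      simp [h1, h2, h3, coeff_X_mul]
  · rw [sub_mul, add_mul, map_sub, map_add, horth (n + 1) k hk.ne', zero_add, smul_mul_assoc,
      map_smul, smul_eq_mul]
    rcases (Nat.lt_succ_iff.mp hk).eq_or_lt with rfl | hk
    · rw [functional_X_mul_orthogonal_mul_self hmonic hdeg horth hdef heven]
      rcases k with _ | k
      · simp [hγ0]
      · rw [horth _ _ (by omega)]
        simp
    · obtain ⟨n, rfl⟩ : ∃ j, n = j + 1 := ⟨n - 1, by omega⟩
      rw [show X * P (n + 1) * P k = P (n + 1) * (X * P k) by ring,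
        functional_orthogonal_mul_eq_coeff hmonic hdeg horth (by rw [hXdeg]; omega),
        coeff_X_mul, Nat.add_sub_cancel]
      rcases (Nat.lt_succ_iff.mp hk).eq_or_lt with rfl | hk
      · rw [hc, hγ, one_mul, sub_self]
      · rw [coeff_eq_zero_of_natDegree_lt (by rwa [hdeg]), horth n k hk.ne']
        simp

theorem functional_X_pow_three_mul_orthogonal (hmonic : ∀ n, (P n).Monic)
    (hdeg : ∀ n, (P n).natDegree = n) (horth : ∀ m n, m ≠ n → L (P m * P n) = 0)
    (hdef : ∀ p, L (p * p) = 0 → p = 0) (heven : ∀ p : ℝ[X], L (p.comp (-X)) = L p)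
    {γ : ℕ → ℝ} (hγ0 : γ 0 = 0)
    (hγ : ∀ n, γ (n + 1) * L (P n * P n) = L (P (n + 1) * P (n + 1))) (n : ℕ) :
    L (X ^ 3 * (P (n + 1) * P n)) =
      (γ (n + 2) + γ (n + 1) + γ n) * L (P (n + 1) * P (n + 1)) := by
  have hrec := X_mul_orthogonal hmonic hdeg horth hdef heven hγ0 hγ
  have hγ' : γ n * γ n * L (P (n - 1) * P (n - 1)) = γ n * L (P n * P n) := by
    rcases n with _ | n
    · simp [hγ0]
    · rw [Nat.add_sub_cancel, mul_assoc, hγ]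
  have hfactor : X ^ 3 * (P (n + 1) * P n) =
      P (n + 2) * P (n + 2) + γ (n + 1) • (P (n + 2) * P n) + γ n • (P (n + 2) * (X * P (n - 1)))
      + γ (n + 1) • (P (n + 1) * P (n + 1)) + (2 * γ (n + 1) * γ n) • (P (n + 1) * P (n - 1))
      + (γ (n + 1) * (γ n * γ n)) • (P (n - 1) * P (n - 1)) := by
    have h1 := hrec n
    have h2 := hrec (n + 1)
    rw [Nat.add_sub_cancel] at h2
    simp only [smul_eq_C_mul, map_mul, map_ofNat] at h1 h2 ⊢
    linear_combination (X ^ 2 * P n) * h2 + P (n + 2) * X * h1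
      + P (n + 2) * h2
      + C (γ (n + 1)) * (X * P n + P (n + 1) + C (γ n) * P (n - 1)) * h1
  have hlow : L (P (n + 2) * (X * P (n - 1))) = 0 := by
    have hd : (X * P (n - 1)).natDegree < n + 2 := by
      rw [natDegree_X_mul (hmonic _).ne_zero, hdeg]
      omega
    rw [functional_orthogonal_mul_eq_coeff hmonic hdeg horth hd.le,
      coeff_eq_zero_of_natDegree_lt hd, zero_mul]
  rw [hfactor]
  simp only [map_add, map_smul, smul_eq_mul, hlow, horth (n + 2) n (by omega),
    horth (n + 1) (n - 1) (by omega)]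
  linear_combination -hγ (n + 1) + γ (n + 1) * hγ' + γ n * hγ n

theorem functional_derivative_orthogonal_mul (hmonic : ∀ n, (P n).Monic)
    (hdeg : ∀ n, (P n).natDegree = n) (horth : ∀ m n, m ≠ n → L (P m * P n) = 0) (n : ℕ) :
    L (derivative (P (n + 1) * P n)) = (n + 1) * L (P n * P n) := by
  have h1 : (derivative (P (n + 1))).natDegree ≤ n := by
    have := natDegree_derivative_le (P (n + 1))
    rwa [hdeg] at this
  have h2 : (derivative (P n)).natDegree < n + 1 := by
    have := natDegree_derivative_le (P n)
    rw [hdeg] at this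
    omega
  have hc : (P (n + 1)).coeff (n + 1) = 1 := by
    have := (hmonic (n + 1)).coeff_natDegree
    rwa [hdeg] at this
  rw [derivative_mul, map_add, mul_comm (derivative (P (n + 1))),
    functional_orthogonal_mul_eq_coeff hmonic hdeg horth h1,
    functional_orthogonal_mul_eq_coeff hmonic hdeg horth h2.le,
    coeff_eq_zero_of_natDegree_lt h2, coeff_derivative, hc]
  ring

end Orthogonal

/-- The recursive coefficients of the monic orthogonal polynomials of the quartic
matrix model satisfy the discrete Painlevé I (string) equation. -/
theorem quartic_dPI (N g : ℝ) (hN : 0 < N) (hg : g < 0)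
    (P : ℕ → Polynomial ℝ)
    (hmonic : ∀ n, (P n).Monic)
    (hdeg : ∀ n, (P n).natDegree = n)
    (horth : ∀ m n, m ≠ n →
      ∫ x : ℝ, (P m).eval x * (P n).eval x * quarticWeight N g x = 0)
    (h : ℕ → ℝ)
    (hh : ∀ n, h n = ∫ x : ℝ, ((P n).eval x) ^ 2 * quarticWeight N g x)
    (γ : ℕ → ℝ)
    (hγ0 : γ 0 = 0)
    (hγ : ∀ n, 1 ≤ n → γ n = h n / h (n - 1)) :
    ∀ n : ℕ, 1 ≤ n →
      (n : ℝ) / N = γ n - g * γ n * (γ (n + 1) + γ n + γ (n - 1)) := by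
  set L := quarticFunctional hN hg with hL
  have horth' : ∀ m n, m ≠ n → L (P m * P n) = 0 := fun m n hmn => by
    rw [hL, quarticFunctional_apply]
    simpa using horth m n hmn
  have hnorm : ∀ n, h n = L (P n * P n) := fun n => by
    rw [hh, hL, quarticFunctional_apply]
    simp [sq]
  have hdef : ∀ p, L (p * p) = 0 → p = 0 := fun p =>
    eq_zero_of_quarticFunctional_mul_self_eq_zero hN hg
  have heven : ∀ p : ℝ[X], L (p.comp (-X)) = L p := quarticFunctional_comp_neg_X hN hg
  have hne : ∀ n, L (P n * P n) ≠ 0 := fun n hn => (hmonic n).ne_zero (hdef _ hn)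
  have hγ' : ∀ n, γ (n + 1) * L (P n * P n) = L (P (n + 1) * P (n + 1)) := fun n => by
    rw [hγ (n + 1) (by omega), Nat.add_sub_cancel, hnorm, hnorm, div_mul_cancel₀ _ (hne n)]
  intro n hn
  obtain ⟨n, rfl⟩ : ∃ j, n = j + 1 := ⟨n - 1, by omega⟩
  have hX : L (X * (P (n + 1) * P n)) = L (P (n + 1) * P (n + 1)) := by
    have hrec := X_mul_orthogonal hmonic hdeg horth' hdef heven hγ0 hγ' n
    rw [mul_left_comm, hrec, mul_add, mul_smul_comm, map_add, map_smul,
      horth' (n + 1) (n - 1) (by omega), smul_zero, add_zero]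
  have hstring := quarticFunctional_derivative hN hg (P (n + 1) * P n)
  rw [← hL, functional_derivative_orthogonal_mul hmonic hdeg horth', hX,
    functional_X_pow_three_mul_orthogonal hmonic hdeg horth' hdef heven hγ0 hγ', ← hγ'] at hstring
  rw [Nat.add_sub_cancel, div_eq_iff hN.ne']
  apply mul_right_cancel₀ (hne n)
  push_cast
  linear_combination hstring
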